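/- Let n ∈ ℕ, n ≥ 1, let K ⊂ ℝⁿ be a nonempty compact set, let a^{jk} : ℝⁿ → ℝ (1 ≤ j,k ≤ n) be smooth with a^{jk} = a^{kj}, let φ : ℝⁿ → ℝ be smooth, μ₀ > 0, c₀ > 0, c₁ > 0, T > 0, and assume condition (d1): Σ_{j,k=1}^n { Σ_{j',k'=1}^n [ 2a^{jk'}(a^{j'k}φ_{x_{j'}})_{x_{k'}} − (∂_{x_{k'}}a^{jk}) a^{j'k'}φ_{x_{j'}} ] } ξ_j ξ_k ≥ μ₀ Σ_{j,k=1}^n a^{jk} ξ_j ξ_k for all x ∈ K and ξ ∈ ℝⁿ. For λ > 0 define ℓ(t,x) := λ[ φ(x) − c₁(t − T/2)² ], Ψ := ℓ_{tt} + Σ_{j,k=1}^n (a^{jk}ℓ_{x_j})_{x_k} − c₀λ, 𝒜 := (ℓ_t² − ℓ_{tt}) − Σ_{j,k=1}^n [ a^{jk}ℓ_{x_j}ℓ_{x_k} − (a^{jk}ℓ_{x_j})_{x_k} ] − Ψ, and ℬ := 𝒜Ψ + (𝒜ℓ_t)_t − Σ_{j,k=1}^n (𝒜 a^{jk}ℓ_{x_j})_{x_k}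 + (1/2)[ Ψ_{tt} − Σ_{j,k=1}^n (a^{jk}Ψ_{x_j})_{x_k} ]. Then there exists a constant C > 0 (depending on n, T, c₀, c₁ and the coefficients a^{jk} and φ, but not on λ, t, x) such that for all λ ≥ 1, all t ∈ [0,T] and all x ∈ K: ℬ(t,x) ≥ (μ₀ + 4c₁ + c₀) λ³ Σ_{j,k=1}^n a^{jk}(x)φ_{x_j}(x)φ_{x_k}(x) − 8 c₁² (4c₁ + c₀) (t − T/2)² λ³ − C λ². -/

import Mathlib

open scoped BigOperators

/-- Partial derivative in the `j`-th coordinate of `ℝⁿ`. -/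
noncomputable def pd {n : ℕ} (j : Fin n) (f : (Fin n → ℝ) → ℝ) : (Fin n → ℝ) → ℝ :=
  fun x => fderiv ℝ f x (Pi.single j 1)

/-- Partial derivative in time (first component of `ℝ × ℝⁿ`). -/
noncomputable def pt {n : ℕ} (f : ℝ × (Fin n → ℝ) → ℝ) : ℝ × (Fin n → ℝ) → ℝ :=
  fun p => fderiv ℝ f p (1, 0)

/-- Partial derivative in the `j`-th spatial coordinate of `ℝ × ℝⁿ`. -/
noncomputable def px {n : ℕ} (j : Fin n) (f : ℝ × (Fin n → ℝ) → ℝ) : ℝ × (Fin n → ℝ) → ℝ :=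
  fun p => fderiv ℝ f p (0, Pi.single j 1)


section Aux
variable {n : ℕ}

lemma pt_split (u : ℝ → ℝ) (v : (Fin n → ℝ) → ℝ) (u' : ℝ) (p : ℝ × (Fin n → ℝ))
    (hu : HasDerivAt u u' p.1) (hv : DifferentiableAt ℝ v p.2) :
    pt (fun q => u q.1 + v q.2) p = u' := by
  have h1 : HasFDerivAt (fun q : ℝ × (Fin n → ℝ) => u q.1) _ p :=
    hu.hasFDerivAt.comp p hasFDerivAt_fst
  have h2 : HasFDerivAt (fun q : ℝ × (Fin n → ℝ) => v q.2) _ p :=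
    hv.hasFDerivAt.comp p hasFDerivAt_snd
  unfold pt
  rw [(h1.fun_add h2).fderiv]
  simp

lemma px_split (k : Fin n) (u : ℝ → ℝ) (v : (Fin n → ℝ) → ℝ) (p : ℝ × (Fin n → ℝ))
    (hu : DifferentiableAt ℝ u p.1) (hv : DifferentiableAt ℝ v p.2) :
    px k (fun q => u q.1 + v q.2) p = pd k v p.2 := by
  have h1 : HasFDerivAt (fun q : ℝ × (Fin n → ℝ) => u q.1) _ p :=
    hu.hasFDerivAt.comp p hasFDerivAt_fst
  have h2 : HasFDerivAt (fun q : ℝ × (Fin n → ℝ) => v q.2) _ p :=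
    hv.hasFDerivAt.comp p hasFDerivAt_snd
  unfold px pd
  rw [(h1.fun_add h2).fderiv]
  simp

lemma px_snd (k : Fin n) (v : (Fin n → ℝ) → ℝ) (p : ℝ × (Fin n → ℝ))
    (hv : DifferentiableAt ℝ v p.2) :
    px k (fun q => v q.2) p = pd k v p.2 := by
  have := px_split k (fun _ => 0) v p (differentiableAt_const _) hv
  simpa using this

lemma pt_mul (f g : ℝ × (Fin n → ℝ) → ℝ) (p : ℝ × (Fin n → ℝ))
    (hf : DifferentiableAt ℝ f p) (hg : DifferentiableAt ℝ g p) :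
    pt (fun q => f q * g q) p = f p * pt g p + g p * pt f p := by
  unfold pt
  rw [fderiv_fun_mul hf hg]
  simp

lemma px_mul (k : Fin n) (f g : ℝ × (Fin n → ℝ) → ℝ) (p : ℝ × (Fin n → ℝ))
    (hf : DifferentiableAt ℝ f p) (hg : DifferentiableAt ℝ g p) :
    px k (fun q => f q * g q) p = f p * px k g p + g p * px k f p := by
  unfold px
  rw [fderiv_fun_mul hf hg]
  simp

lemma pd_mul (k : Fin n) (f g : (Fin n → ℝ) → ℝ) (p : Fin n → ℝ)
    (hf : DifferentiableAt ℝ f p) (hg : DifferentiableAt ℝ g p) :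
    pd k (fun q => f q * g q) p = f p * pd k g p + g p * pd k f p := by
  unfold pd
  rw [fderiv_fun_mul hf hg]
  simp

lemma pd_const_mul (k : Fin n) (c : ℝ) (f : (Fin n → ℝ) → ℝ) (p : Fin n → ℝ)
    (hf : DifferentiableAt ℝ f p) :
    pd k (fun q => c * f q) p = c * pd k f p := by
  rw [pd_mul k _ _ p (differentiableAt_const _) hf]
  simp [pd]

lemma pd_add_const (k : Fin n) (c : ℝ) (f : (Fin n → ℝ) → ℝ) (p : Fin n → ℝ) :
    pd k (fun q => f q + c) p = pd k f p := by
  unfold pd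
  rw [fderiv_add_const]

lemma pd_sum {ι : Type*} (s : Finset ι) (k : Fin n) (f : ι → (Fin n → ℝ) → ℝ) (p : Fin n → ℝ)
    (hf : ∀ i, DifferentiableAt ℝ (f i) p) :
    pd k (fun q => ∑ i ∈ s, f i q) p = ∑ i ∈ s, pd k (f i) p := by
  unfold pd
  rw [fderiv_fun_sum (fun i _ => hf i)]
  simp

lemma pd_smooth (k : Fin n) (f : (Fin n → ℝ) → ℝ) (hf : ContDiff ℝ (⊤ : ℕ∞) f) :
    ContDiff ℝ (⊤ : ℕ∞) (pd k f) := by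
  unfold pd
  exact (hf.fderiv_right (m := (⊤ : ℕ∞)) (by simp)).clm_apply contDiff_const

lemma smooth_diff {f : (Fin n → ℝ) → ℝ} (hf : ContDiff ℝ (⊤ : ℕ∞) f) : Differentiable ℝ f :=
  hf.differentiable (by simp)

lemma pt_eq (F : ℝ × (Fin n → ℝ) → ℝ) (u : ℝ → ℝ) (v : (Fin n → ℝ) → ℝ) (u' : ℝ)
    (p : ℝ × (Fin n → ℝ)) (hF : ∀ q, F q = u q.1 + v q.2)
    (hu : HasDerivAt u u' p.1) (hv : DifferentiableAt ℝ v p.2) : pt F p = u' := by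
  rw [funext hF]
  exact pt_split u v u' p hu hv

lemma px_eq (k : Fin n) (F : ℝ × (Fin n → ℝ) → ℝ) (u : ℝ → ℝ) (v : (Fin n → ℝ) → ℝ)
    (p : ℝ × (Fin n → ℝ)) (hF : ∀ q, F q = u q.1 + v q.2)
    (hu : DifferentiableAt ℝ u p.1) (hv : DifferentiableAt ℝ v p.2) : px k F p = pd k v p.2 := by
  rw [funext hF]
  exact px_split k u v p hu hv

lemma px_eq_mul (k : Fin n) (F : ℝ × (Fin n → ℝ) → ℝ) (c : ℝ) (v : (Fin n → ℝ) → ℝ)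
    (p : ℝ × (Fin n → ℝ)) (hF : ∀ q, F q = c * v q.2)
    (hv : DifferentiableAt ℝ v p.2) : px k F p = c * pd k v p.2 := by
  rw [px_eq k F (fun _ => 0) (fun y => c * v y) p (fun q => by rw [hF]; ring)
    (differentiableAt_const _) (hv.const_mul _), pd_const_mul _ _ _ _ hv]

/-- `∑ (a^{jk} φ_j)_k`. -/
noncomputable def auxL (a : Fin n → Fin n → (Fin n → ℝ) → ℝ) (φ : (Fin n → ℝ) → ℝ) :
    (Fin n → ℝ) → ℝ :=
  fun x => ∑ j, ∑ k, pd k (fun y => a j k y * pd j φ y) x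

/-- `∑ a^{jk} φ_j φ_k`. -/
noncomputable def auxG (a : Fin n → Fin n → (Fin n → ℝ) → ℝ) (φ : (Fin n → ℝ) → ℝ) :
    (Fin n → ℝ) → ℝ :=
  fun x => ∑ j, ∑ k, a j k x * pd j φ x * pd k φ x

lemma auxL_smooth (a : Fin n → Fin n → (Fin n → ℝ) → ℝ)
    (ha : ∀ j k, ContDiff ℝ (⊤ : ℕ∞) (a j k))
    (φ : (Fin n → ℝ) → ℝ) (hφ : ContDiff ℝ (⊤ : ℕ∞) φ) :
    ContDiff ℝ (⊤ : ℕ∞) (auxL a φ) := by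
  unfold auxL
  exact ContDiff.sum fun j _ => ContDiff.sum fun k _ =>
    pd_smooth k _ ((ha j k).mul (pd_smooth j φ hφ))

lemma auxG_smooth (a : Fin n → Fin n → (Fin n → ℝ) → ℝ)
    (ha : ∀ j k, ContDiff ℝ (⊤ : ℕ∞) (a j k))
    (φ : (Fin n → ℝ) → ℝ) (hφ : ContDiff ℝ (⊤ : ℕ∞) φ) :
    ContDiff ℝ (⊤ : ℕ∞) (auxG a φ) := by
  unfold auxG
  exact ContDiff.sum fun j _ => ContDiff.sum fun k _ =>
    ((ha j k).mul (pd_smooth j φ hφ)).mul (pd_smooth k φ hφ)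

lemma pd_auxG (a : Fin n → Fin n → (Fin n → ℝ) → ℝ)
    (ha : ∀ j k, ContDiff ℝ (⊤ : ℕ∞) (a j k)) (hasym : ∀ j k, a j k = a k j)
    (φ : (Fin n → ℝ) → ℝ) (hφ : ContDiff ℝ (⊤ : ℕ∞) φ) (m : Fin n) (x : Fin n → ℝ) :
    pd m (auxG a φ) x = (∑ j, ∑ k, pd m (a j k) x * pd j φ x * pd k φ x)
      + 2 * ∑ j, ∑ k, a j k x * pd m (pd j φ) x * pd k φ x := by
  have hp : ∀ j, Differentiable ℝ (pd j φ) := fun j => smooth_diff (pd_smooth j φ hφ)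
  have hd : ∀ j k, Differentiable ℝ (a j k) := fun j k => smooth_diff (ha j k)
  have h1 : pd m (auxG a φ) x = ∑ j, ∑ k, (pd m (a j k) x * pd j φ x * pd k φ x
      + a j k x * pd m (pd j φ) x * pd k φ x + a j k x * pd m (pd k φ) x * pd j φ x) := by
    unfold auxG
    rw [pd_sum]
    · refine Finset.sum_congr rfl fun j _ => ?_
      rw [pd_sum]
      · refine Finset.sum_congr rfl fun k _ => ?_
        rw [pd_mul m (fun y => a j k y * pd j φ y) _ x ((hd j k x).mul (hp j x)) (hp k x),
          pd_mul m _ _ x (hd j k x) (hp j x)]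
        ring
      · exact fun k => ((hd j k x).mul (hp j x)).mul (hp k x)
    · intro j
      exact DifferentiableAt.fun_sum fun k _ => ((hd j k x).mul (hp j x)).mul (hp k x)
  have h2 : ∑ j, ∑ k, a j k x * pd m (pd k φ) x * pd j φ x
      = ∑ j, ∑ k, a j k x * pd m (pd j φ) x * pd k φ x := by
    rw [Finset.sum_comm]
    refine Finset.sum_congr rfl fun j _ => Finset.sum_congr rfl fun k _ => ?_
    rw [hasym k j]
  rw [h1]
  simp only [Finset.sum_add_distrib]
  rw [h2]
  ring

lemma quad_le (a : Fin n → Fin n → (Fin n → ℝ) → ℝ)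
    (ha : ∀ j k, ContDiff ℝ (⊤ : ℕ∞) (a j k)) (hasym : ∀ j k, a j k = a k j)
    (φ : (Fin n → ℝ) → ℝ) (hφ : ContDiff ℝ (⊤ : ℕ∞) φ) (x : Fin n → ℝ) :
    ∑ j, ∑ k,
          (∑ j', ∑ k',
            (2 * a j k' x * pd k' (fun y => a j' k y * pd j' φ y) x
              - pd k' (a j k) x * a j' k' x * pd j' φ x)) * pd j φ x * pd k φ x
    = ∑ j, ∑ k, a j k x * pd j φ x * pd k (auxG a φ) x := by
  have hp : ∀ j, Differentiable ℝ (pd j φ) := fun j => smooth_diff (pd_smooth j φ hφ)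
  have hd : ∀ j k, Differentiable ℝ (a j k) := fun j k => smooth_diff (ha j k)
  simp only [pd_auxG a ha hasym φ hφ, fun j' k m => pd_mul m _ _ x (hd j' k x) (hp j' x)]
  have hl : ∀ F : Fin n → Fin n → Fin n → Fin n → ℝ,
      ∑ j, ∑ k, ∑ j', ∑ m, F j k j' m = ∑ j', ∑ m, ∑ j, ∑ k, F j k j' m := by
    intro F
    have e1 : ∀ j, ∑ k, ∑ j', ∑ m, F j k j' m = ∑ j', ∑ m, ∑ k, F j k j' m := by
      intro j
      rw [Finset.sum_comm]
      exact Finset.sum_congr rfl fun j' _ => Finset.sum_comm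
    simp only [e1]
    rw [Finset.sum_comm]
    exact Finset.sum_congr rfl fun j' _ => Finset.sum_comm
  have hs : ∀ F : Fin n → Fin n → Fin n → Fin n → ℝ,
      ∑ j, ∑ k, ∑ j', ∑ m, F j k j' m = ∑ j, ∑ m, ∑ j', ∑ k, F j k j' m := by
    intro F
    refine Finset.sum_congr rfl fun j _ => ?_
    have e1 : ∀ k, ∑ j', ∑ m, F j k j' m = ∑ m, ∑ j', F j k j' m := fun k => Finset.sum_comm
    simp only [e1]
    rw [Finset.sum_comm]
    exact Finset.sum_congr rfl fun j' _ => Finset.sum_comm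
  have hL : ∀ j k, (∑ j', ∑ k',
            (2 * a j k' x * (a j' k x * pd k' (pd j' φ) x + pd j' φ x * pd k' (a j' k) x)
              - pd k' (a j k) x * a j' k' x * pd j' φ x)) * pd j φ x * pd k φ x
      = (∑ j', ∑ k', (a j k' x * pd j φ x *
          (pd k' (a j' k) x * pd j' φ x * pd k φ x * 2 + 2 * (a j' k x * pd k' (pd j' φ) x * pd k φ x))))
        - ∑ j', ∑ k', a j' k' x * pd j' φ x * (pd k' (a j k) x * pd j φ x * pd k φ x) := by
    intro j k
    simp only [Finset.sum_mul, ← Finset.sum_sub_distrib]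
    refine Finset.sum_congr rfl fun j' _ => Finset.sum_congr rfl fun k' _ => ?_
    ring
  simp only [hL]
  simp only [Finset.sum_sub_distrib]
  rw [hs, hl (fun j k j' k' => a j' k' x * pd j' φ x * (pd k' (a j k) x * pd j φ x * pd k φ x))]
  simp only [← Finset.sum_sub_distrib]
  refine Finset.sum_congr rfl fun j _ => Finset.sum_congr rfl fun m _ => ?_
  simp only [mul_add, Finset.mul_sum, ← Finset.sum_add_distrib]
  refine Finset.sum_congr rfl fun j' _ => Finset.sum_congr rfl fun k _ => ?_
  ring

end Aux

/-- The lower bound (B ine) on the zeroth-order coefficient `ℬ` in the Carleman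
estimate, valid for all `λ ≥ 1` with a constant `C` independent of `λ`, `t`, `x`. -/
theorem stmt10 (n : ℕ) (hn : 1 ≤ n)
    (K : Set (Fin n → ℝ)) (hKne : K.Nonempty) (hKcp : IsCompact K)
    (a : Fin n → Fin n → (Fin n → ℝ) → ℝ)
    (ha : ∀ j k, ContDiff ℝ (⊤ : ℕ∞) (a j k))
    (hasym : ∀ j k, a j k = a k j)
    (φ : (Fin n → ℝ) → ℝ) (hφ : ContDiff ℝ (⊤ : ℕ∞) φ)
    (μ₀ c₀ c₁ T : ℝ) (hμ₀ : 0 < μ₀) (hc₀ : 0 < c₀) (hc₁ : 0 < c₁) (hT : 0 < T)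
    (hd1 : ∀ x ∈ K, ∀ ξ : Fin n → ℝ,
      μ₀ * (∑ j, ∑ k, a j k x * ξ j * ξ k) ≤
        ∑ j, ∑ k,
          (∑ j', ∑ k',
            (2 * a j k' x * pd k' (fun y => a j' k y * pd j' φ y) x
              - pd k' (a j k) x * a j' k' x * pd j' φ x)) * ξ j * ξ k)
    (ℓ : ℝ → ℝ × (Fin n → ℝ) → ℝ)
    (hℓ : ∀ lam : ℝ, ℓ lam = fun p => lam * (φ p.2 - c₁ * (p.1 - T/2) ^ 2))
    (Ψ : ℝ → ℝ × (Fin n → ℝ) → ℝ)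
    (hΨ : ∀ lam : ℝ, Ψ lam = fun p =>
      pt (pt (ℓ lam)) p
      + (∑ j, ∑ k, px k (fun q => a j k q.2 * px j (ℓ lam) q) p) - c₀ * lam)
    (A : ℝ → ℝ × (Fin n → ℝ) → ℝ)
    (hA : ∀ lam : ℝ, A lam = fun p =>
      (pt (ℓ lam) p ^ 2 - pt (pt (ℓ lam)) p)
      - (∑ j, ∑ k, (a j k p.2 * px j (ℓ lam) p * px k (ℓ lam) p
          - px k (fun q => a j k q.2 * px j (ℓ lam) q) p))
      - Ψ lam p)
    (B : ℝ → ℝ × (Fin n → ℝ) → ℝ)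
    (hB : ∀ lam : ℝ, B lam = fun p =>
      A lam p * Ψ lam p + pt (fun q => A lam q * pt (ℓ lam) q) p
      - (∑ j, ∑ k, px k (fun q => A lam q * a j k q.2 * px j (ℓ lam) q) p)
      + (1/2) * (pt (pt (Ψ lam)) p
          - ∑ j, ∑ k, px k (fun q => a j k q.2 * px j (Ψ lam) q) p)) :
    ∃ C > 0, ∀ lam : ℝ, 1 ≤ lam → ∀ t ∈ Set.Icc (0:ℝ) T, ∀ x ∈ K,
      (μ₀ + 4 * c₁ + c₀) * lam ^ 3 * (∑ j, ∑ k, a j k x * pd j φ x * pd k φ x)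
        - 8 * c₁ ^ 2 * (4 * c₁ + c₀) * (t - T/2) ^ 2 * lam ^ 3
        - C * lam ^ 2
      ≤ B lam (t, x) := by
  have hGs := auxG_smooth a ha φ hφ
  have hLs := auxL_smooth a ha φ hφ
  have hGd := smooth_diff hGs
  have hLd := smooth_diff hLs
  have hφd := smooth_diff hφ
  have hp : ∀ j, Differentiable ℝ (pd j φ) := fun j => smooth_diff (pd_smooth j φ hφ)
  have hd : ∀ j k, Differentiable ℝ (a j k) := fun j k => smooth_diff (ha j k)
  have hLp : ∀ j, Differentiable ℝ (pd j (auxL a φ)) := fun j => smooth_diff (pd_smooth j _ hLs)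
  -- derivatives of the weight
  have hℓt : ∀ lam, pt (ℓ lam) = fun p => -2 * c₁ * lam * (p.1 - T/2) := by
    intro lam
    funext p
    refine pt_eq (ℓ lam) (fun s => -(lam * c₁) * (s - T/2) ^ 2) (fun y => lam * φ y) _ p
      (fun q => by rw [hℓ]; ring) ?_ ((hφd _).const_mul _)
    have := ((((hasDerivAt_id p.1).sub_const (T/2)).pow 2).const_mul (-(lam * c₁)))
    exact this.congr_deriv (by simp; ring)
  have hℓx : ∀ lam j, px j (ℓ lam) = fun p => lam * pd j φ p.2 := by
    intro lam j
    funext p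
    rw [px_eq j (ℓ lam) (fun s => -(lam * c₁) * (s - T/2) ^ 2) (fun y => lam * φ y) p
      (fun q => by rw [hℓ]; ring) (by fun_prop) ((hφd _).const_mul _),
      pd_const_mul _ _ _ _ (hφd _)]
  have hℓtt : ∀ lam, pt (pt (ℓ lam)) = fun _ => -2 * c₁ * lam := by
    intro lam
    funext p
    refine pt_eq (pt (ℓ lam)) (fun s => -2 * c₁ * lam * (s - T/2)) (fun _ => (0:ℝ)) _ p
      (fun q => by rw [hℓt]; ring) ?_ (differentiableAt_const _)
    have := (((hasDerivAt_id p.1).sub_const (T/2)).const_mul (-2 * c₁ * lam))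
    exact this.congr_deriv (by simp)
  have hdiv : ∀ lam j k p, px k (fun q => a j k q.2 * px j (ℓ lam) q) p
      = lam * pd k (fun y => a j k y * pd j φ y) p.2 := by
    intro lam j k p
    exact px_eq_mul k _ lam (fun y => a j k y * pd j φ y) p (fun q => by rw [hℓx]; ring)
      ((hd j k _).mul (hp j _))
  have hΨ' : ∀ lam, Ψ lam = fun p => lam * (auxL a φ p.2 - 2 * c₁ - c₀) := by
    intro lam
    rw [hΨ]
    funext p
    simp only [hℓtt, hdiv, ← Finset.mul_sum]
    unfold auxL
    ring
  have hA' : ∀ lam, A lam = fun q => (fun s => 4 * c₁ ^ 2 * lam ^ 2 * (s - T/2) ^ 2) q.1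
      + (fun y => (-lam ^ 2) * auxG a φ y + lam * (4 * c₁ + c₀)) q.2 := by
    intro lam
    rw [hA]
    funext p
    have e : ∑ j, ∑ k, a j k p.2 * px j (ℓ lam) p * px k (ℓ lam) p = lam ^ 2 * auxG a φ p.2 := by
      unfold auxG
      simp only [hℓx, Finset.mul_sum]
      refine Finset.sum_congr rfl fun j _ => Finset.sum_congr rfl fun k _ => ?_
      ring
    simp only [Finset.sum_sub_distrib, e]
    simp only [hℓtt, hdiv, hΨ', ← Finset.mul_sum]
    rw [hℓt]
    have e2 : ∑ j, ∑ k, pd k (fun y => a j k y * pd j φ y) p.2 = auxL a φ p.2 := rfl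
    rw [e2]
    ring
  have hAd : ∀ lam p, DifferentiableAt ℝ (A lam) p := by
    intro lam p
    rw [hA']
    have h2 : DifferentiableAt ℝ (fun q : ℝ × (Fin n → ℝ) => auxG a φ q.2) p :=
      (hGd _).comp p differentiableAt_snd
    fun_prop
  have hAt : ∀ lam p, pt (A lam) p = 8 * c₁ ^ 2 * lam ^ 2 * (p.1 - T/2) := by
    intro lam p
    refine pt_eq (A lam) (fun s => 4 * c₁ ^ 2 * lam ^ 2 * (s - T/2) ^ 2)
      (fun y => (-lam ^ 2) * auxG a φ y + lam * (4 * c₁ + c₀)) _ p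
      (fun q => by rw [hA']) ?_ (((hGd _).const_mul _).add_const _)
    have := ((((hasDerivAt_id p.1).sub_const (T/2)).pow 2).const_mul (4 * c₁ ^ 2 * lam ^ 2))
    exact this.congr_deriv (by simp; ring)
  have hAx : ∀ lam k p, px k (A lam) p = -lam ^ 2 * pd k (auxG a φ) p.2 := by
    intro lam k p
    rw [px_eq k (A lam) (fun s => 4 * c₁ ^ 2 * lam ^ 2 * (s - T/2) ^ 2)
      (fun y => (-lam ^ 2) * auxG a φ y + lam * (4 * c₁ + c₀)) p
      (fun q => by rw [hA']) (by fun_prop) (((hGd _).const_mul _).add_const _),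
      pd_add_const, pd_const_mul _ _ _ _ (hGd _)]
  have hΨt : ∀ lam, pt (Ψ lam) = fun _ => 0 := by
    intro lam
    funext p
    exact pt_eq (Ψ lam) (fun _ => (0:ℝ)) (fun y => lam * (auxL a φ y - 2 * c₁ - c₀)) _ p
      (fun q => by rw [hΨ']; ring) (hasDerivAt_const _ _)
      ((((hLd _).sub_const _).sub_const _).const_mul _)
  have hΨtt : ∀ lam p, pt (pt (Ψ lam)) p = 0 := by
    intro lam p
    rw [hΨt]
    simp [pt]
  have hΨx : ∀ lam j, px j (Ψ lam) = fun p => lam * pd j (auxL a φ) p.2 := by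
    intro lam j
    funext p
    rw [px_eq j (Ψ lam) (fun _ => (0:ℝ)) (fun y => lam * auxL a φ y + lam * (- 2 * c₁ - c₀)) p
      (fun q => by rw [hΨ']; ring) (differentiableAt_const _) (((hLd _).const_mul _).add_const _),
      pd_add_const, pd_const_mul _ _ _ _ (hLd _)]
  have hdivΨ : ∀ lam p, ∑ j, ∑ k, px k (fun q => a j k q.2 * px j (Ψ lam) q) p
      = lam * auxL a (auxL a φ) p.2 := by
    intro lam p
    have e : auxL a (auxL a φ) p.2
        = ∑ j, ∑ k, pd k (fun y => a j k y * pd j (auxL a φ) y) p.2 := rfl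
    rw [e]
    simp only [Finset.mul_sum]
    refine Finset.sum_congr rfl fun j _ => Finset.sum_congr rfl fun k _ => ?_
    exact px_eq_mul k _ lam (fun y => a j k y * pd j (auxL a φ) y) p
      (fun q => by rw [hΨx]; ring) ((hd j k _).mul (hLp j _))
  have hAℓt : ∀ lam p, pt (fun q => A lam q * pt (ℓ lam) q) p
      = -2 * c₁ * lam * A lam p - 16 * c₁ ^ 3 * lam ^ 3 * (p.1 - T/2) ^ 2 := by
    intro lam p
    rw [pt_mul _ _ _ (hAd lam p) (by rw [hℓt]; fun_prop), hAt, hℓtt, hℓt]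
    ring
  have hAdiv : ∀ lam p, ∑ j, ∑ k, px k (fun q => A lam q * a j k q.2 * px j (ℓ lam) q) p
      = lam * A lam p * auxL a φ p.2
        - lam ^ 3 * ∑ j, ∑ k, a j k p.2 * pd j φ p.2 * pd k (auxG a φ) p.2 := by
    intro lam p
    unfold auxL
    simp only [Finset.mul_sum, ← Finset.sum_sub_distrib]
    refine Finset.sum_congr rfl fun j _ => Finset.sum_congr rfl fun k _ => ?_
    have e : (fun q : ℝ × (Fin n → ℝ) => A lam q * a j k q.2 * px j (ℓ lam) q)
        = fun q => A lam q * (a j k q.2 * px j (ℓ lam) q) := by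
      funext q; ring
    have hdd : DifferentiableAt ℝ (fun q : ℝ × (Fin n → ℝ) => a j k q.2 * px j (ℓ lam) q) p := by
      rw [hℓx]
      have h1 : DifferentiableAt ℝ (fun q : ℝ × (Fin n → ℝ) => a j k q.2) p :=
        (hd j k _).comp p differentiableAt_snd
      have h2 : DifferentiableAt ℝ (fun q : ℝ × (Fin n → ℝ) => pd j φ q.2) p :=
        (hp j _).comp p differentiableAt_snd
      exact h1.mul (h2.const_mul _)
    rw [e, px_mul _ _ _ _ (hAd lam p) hdd, hdiv, hAx, hℓx]
    ring
  obtain ⟨M, hM⟩ := hKcp.exists_bound_of_continuousOn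
    (auxL_smooth a ha _ hLs).continuous.continuousOn
  have hM0 : 0 ≤ M := by
    obtain ⟨x, hx⟩ := hKne
    exact (norm_nonneg _).trans (hM x hx)
  refine ⟨(4 * c₁ + c₀) ^ 2 + M + 1, by positivity, ?_⟩
  intro lam hlam t _ x hx
  have hH := hd1 x hx (fun j => pd j φ x)
  rw [quad_le a ha hasym φ hφ x] at hH
  have eG : ∑ j, ∑ k, a j k x * pd j φ x * pd k φ x = auxG a φ x := rfl
  rw [eG] at hH ⊢
  rw [hB]
  simp only [hAℓt, hAdiv, hdivΨ, hΨtt]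
  simp only [hΨ', hA']
  set H := ∑ j, ∑ k, a j k x * pd j φ x * pd k (auxG a φ) x
  have hMx := (abs_le.mp (hM x hx)).2
  have hl3 : 0 ≤ lam ^ 3 := by positivity
  have h1 : 0 ≤ lam ^ 3 * (H - μ₀ * auxG a φ x) := mul_nonneg hl3 (by linarith)
  have h2 : 0 ≤ c₁ ^ 2 * c₀ * (t - T/2) ^ 2 * lam ^ 3 := by positivity
  have h3 : 0 ≤ lam * (M - auxL a (auxL a φ) x) := mul_nonneg (by linarith) (by linarith)
  have h4 : 0 ≤ M * (lam * (lam - 1)) :=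
    mul_nonneg hM0 (mul_nonneg (by linarith) (by linarith))
  have h5 : 0 ≤ M * lam := mul_nonneg hM0 (by linarith)
  have h6 : 0 ≤ lam ^ 2 := by positivity
  nlinarith
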